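/- arXiv:2111.02672 — 4 statements merged into one kernel-verified Lean document; each statement's English description precedes it below -/
import Mathlib

section
/- Let X be a real normed space and s ∈ (0, 1], and suppose X satisfies the Clarkson-type inequality: for all x, y ∈ X, (‖x+y‖^{2/s} + ‖x−y‖^{2/s})^{s/2} ≤ 2^{s/2} (‖x‖^{2/(2−s)} + ‖y‖^{2/(2−s)})^{(2−s)/2}. Then for every ε ∈ (0, 2] and all x, y ∈ X with ‖x‖ = ‖y‖ = 1 and ‖x−y‖ = ε, one has ‖(x+y)/2‖ ≤ (1/2)(2^{2/s} − ε^{2/s})^{s/2}; equivalently, the modulus of convexity satisfies δ_X(ε) ≥ 1 − (1/2)(2^{2/s} − ε^{2/s})^{s/2}. -/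
theorem modulus_of_convexity_bound_of_clarkson
    {X : Type*} [NormedAddCommGroup X] [NormedSpace ℝ X]
    (s : ℝ) (hs : 0 < s) (hs1 : s ≤ 1)
    (hC : ∀ x y : X,
      (‖x + y‖ ^ (2 / s) + ‖x - y‖ ^ (2 / s)) ^ (s / 2) ≤
        2 ^ (s / 2) * (‖x‖ ^ (2 / (2 - s)) + ‖y‖ ^ (2 / (2 - s))) ^ ((2 - s) / 2))
    (ε : ℝ) (hε : 0 < ε) (hε2 : ε ≤ 2)
    (x y : X) (hx : ‖x‖ = 1) (hy : ‖y‖ = 1) (hxy : ‖x - y‖ = ε) :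
    ‖(2⁻¹ : ℝ) • (x + y)‖ ≤ (1 / 2) * (2 ^ (2 / s) - ε ^ (2 / s)) ^ (s / 2) := by
  have h := hC x y
  have hp : 0 < 2 / s := by positivity
  have hinv : s / 2 = (2 / s)⁻¹ := (inv_div 2 s).symm
  have hrhs : (2 : ℝ) ^ (s / 2) * (1 + 1) ^ ((2 - s) / 2) = 2 := by
    rw [one_add_one_eq_two, ← Real.rpow_add two_pos, ← add_div, add_sub_cancel,
      div_self two_ne_zero, Real.rpow_one]
  rw [hx, hy, hxy, Real.one_rpow, hrhs, hinv,
    Real.rpow_inv_le_iff_of_pos (by positivity) zero_le_two hp] at h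
  have hsum : ‖x + y‖ ≤ (2 ^ (2 / s) - ε ^ (2 / s)) ^ (s / 2) := by
    have hpow : 0 ≤ ‖x + y‖ ^ (2 / s) := by positivity
    rw [hinv, Real.le_rpow_inv_iff_of_pos (norm_nonneg _) (by linarith) hp]
    linarith
  rw [norm_smul, Real.norm_of_nonneg (by norm_num), one_div]
  gcongr
end

section
/- Let X be a real normed space and s ∈ (0, 1], and suppose X satisfies the Clarkson-type inequality: for all x, y ∈ X, (‖x+y‖^{2/s} + ‖x−y‖^{2/s})^{s/2} ≤ 2^{s/2} (‖x‖^{2/(2−s)} + ‖y‖^{2/(2−s)})^{(2−s)/2}. Then X is uniformly convex: for every ε > 0 there exists δ > 0 such that for all x, y ∈ X with ‖x‖ ≤ 1, ‖y‖ ≤ 1 and ‖x−y‖ ≥ ε one has ‖(x+y)/2‖ ≤ 1 − δ. -/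
theorem uniformly_convex_of_clarkson
    {X : Type*} [NormedAddCommGroup X] [NormedSpace ℝ X]
    (s : ℝ) (hs : 0 < s) (hs1 : s ≤ 1)
    (hC : ∀ x y : X,
      (‖x + y‖ ^ (2 / s) + ‖x - y‖ ^ (2 / s)) ^ (s / 2) ≤
        2 ^ (s / 2) * (‖x‖ ^ (2 / (2 - s)) + ‖y‖ ^ (2 / (2 - s))) ^ ((2 - s) / 2)) :
    ∀ ε : ℝ, 0 < ε → ∃ δ : ℝ, 0 < δ ∧
      ∀ x y : X, ‖x‖ ≤ 1 → ‖y‖ ≤ 1 → ε ≤ ‖x - y‖ →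
        ‖(2⁻¹ : ℝ) • (x + y)‖ ≤ 1 - δ := by
  intro ε hε
  have hp0 : (0 : ℝ) < 2 / s := by positivity
  have hp1 : 1 ≤ 2 / s := by
    rw [le_div_iff₀ hs]
    linarith
  have hq0 : 0 < 2 - s := by linarith
  have ht : 0 < (ε / 2) ^ (2 / s) := by positivity
  refine ⟨min 1 ((ε / 2) ^ (2 / s) / (2 * (2 / s))), by positivity, ?_⟩
  intro x y hx hy hxy
  set δ := min 1 ((ε / 2) ^ (2 / s) / (2 * (2 / s))) with hδ
  have hδ1 : δ ≤ 1 := min_le_left _ _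
  have hpδ : δ * (2 * (2 / s)) ≤ (ε / 2) ^ (2 / s) :=
    (le_div_iff₀ (by positivity)).1 (min_le_right _ _)
  have hx' : ‖x‖ ^ (2 / (2 - s)) ≤ 1 := Real.rpow_le_one (norm_nonneg _) hx (by positivity)
  have hy' : ‖y‖ ^ (2 / (2 - s)) ≤ 1 := Real.rpow_le_one (norm_nonneg _) hy (by positivity)
  have h2 : (‖x + y‖ ^ (2 / s) + ‖x - y‖ ^ (2 / s)) ^ (s / 2) ≤ 2 := by
    calc
      _ ≤ _ := hC x y
      _ ≤ (2 : ℝ) ^ (s / 2) * 2 ^ ((2 - s) / 2) := by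
        gcongr
        linarith
      _ = 2 := by
        rw [← Real.rpow_add two_pos, show s / 2 + (2 - s) / 2 = 1 by ring, Real.rpow_one]
  have hsum : ‖x + y‖ ^ (2 / s) + ‖x - y‖ ^ (2 / s) ≤ 2 ^ (2 / s) := by
    have h := Real.rpow_le_rpow (by positivity) h2 hp0.le
    rwa [← Real.rpow_mul (by positivity), show s / 2 * (2 / s) = 1 by field_simp,
      Real.rpow_one] at h
  have hmid : (‖x + y‖ / 2) ^ (2 / s) + (ε / 2) ^ (2 / s) ≤ 1 := by
    rw [Real.div_rpow (norm_nonneg _) two_pos.le, Real.div_rpow hε.le two_pos.le, ← add_div,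
      div_le_one (by positivity)]
    have h := Real.rpow_le_rpow hε.le hxy hp0.le
    linarith
  rw [norm_smul, Real.norm_of_nonneg (by norm_num), inv_mul_eq_div]
  by_contra! hlt
  have hbern := one_add_mul_self_le_rpow_one_add (show -1 ≤ -δ by linarith) hp1
  have hmono : (1 + -δ) ^ (2 / s) ≤ (‖x + y‖ / 2) ^ (2 / s) :=
    Real.rpow_le_rpow (by linarith) (by linarith) hp0.le
  linarith
end

section
/- Let X be a real normed space and s ∈ (0, 1], and suppose X satisfies the Clarkson-type inequality: for all x, y ∈ X, (‖x+y‖^{2/s} + ‖x−y‖^{2/s})^{s/2} ≤ 2^{s/2} (‖x‖^{2/(2−s)} + ‖y‖^{2/(2−s)})^{(2−s)/2}. Then for every t > 0 and all x, y ∈ X with ‖x‖ = ‖y‖ = 1, one has ‖x + t·y‖ + ‖x − t·y‖ ≤ 2(1 + t^{2/(2−s)})^{(2−s)/2}; equivalently, the modulus of smoothness satisfies ρ_X(t) ≤ (1 + t^{2/(2−s)})^{(2−s)/2} − 1. -/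
/-- The power mean inequality for two nonnegative reals, in root form. -/
theorem Real.add_le_two_rpow_mul_rpow_add_rpow {a b p : ℝ} (ha : 0 ≤ a) (hb : 0 ≤ b)
    (hp : 1 ≤ p) : a + b ≤ 2 ^ (1 - 1 / p) * (a ^ p + b ^ p) ^ (1 / p) := by
  have hp0 : 0 < p := by linarith
  have h : (a + b) ^ p ≤ 2 ^ (p - 1) * (a ^ p + b ^ p) := by
    lift a to NNReal using ha
    lift b to NNReal using hb
    exact_mod_cast NNReal.rpow_add_le_mul_rpow_add_rpow a b hp
  calc a + b = ((a + b) ^ p) ^ (1 / p) := by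
        rw [one_div, Real.rpow_rpow_inv (by positivity) hp0.ne']
    _ ≤ (2 ^ (p - 1) * (a ^ p + b ^ p)) ^ (1 / p) := by gcongr
    _ = 2 ^ (1 - 1 / p) * (a ^ p + b ^ p) ^ (1 / p) := by
        rw [Real.mul_rpow (by positivity) (by positivity), ← Real.rpow_mul (by norm_num)]
        congr 2
        field_simp

theorem modulus_of_smoothness_bound_of_clarkson
    {X : Type*} [NormedAddCommGroup X] [NormedSpace ℝ X]
    (s : ℝ) (hs : 0 < s) (hs1 : s ≤ 1)
    (hC : ∀ x y : X,
      (‖x + y‖ ^ (2 / s) + ‖x - y‖ ^ (2 / s)) ^ (s / 2) ≤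
        2 ^ (s / 2) * (‖x‖ ^ (2 / (2 - s)) + ‖y‖ ^ (2 / (2 - s))) ^ ((2 - s) / 2))
    (t : ℝ) (ht : 0 < t)
    (x y : X) (hx : ‖x‖ = 1) (hy : ‖y‖ = 1) :
    ‖x + t • y‖ + ‖x - t • y‖ ≤ 2 * (1 + t ^ (2 / (2 - s))) ^ ((2 - s) / 2) := by
  have hp : 1 ≤ 2 / s := by rw [le_div_iff₀ hs]; linarith
  have hclarkson := hC x (t • y)
  rw [norm_smul, hx, hy, Real.norm_of_nonneg ht.le, mul_one, Real.one_rpow] at hclarkson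
  have hmean := Real.add_le_two_rpow_mul_rpow_add_rpow (norm_nonneg (x + t • y))
    (norm_nonneg (x - t • y)) hp
  rw [one_div_div] at hmean
  calc ‖x + t • y‖ + ‖x - t • y‖
      ≤ 2 ^ (1 - s / 2) * (‖x + t • y‖ ^ (2 / s) + ‖x - t • y‖ ^ (2 / s)) ^ (s / 2) := hmean
    _ ≤ 2 ^ (1 - s / 2) * (2 ^ (s / 2) * (1 + t ^ (2 / (2 - s))) ^ ((2 - s) / 2)) := by gcongr
    _ = 2 * (1 + t ^ (2 / (2 - s))) ^ ((2 - s) / 2) := by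
        rw [← mul_assoc, ← Real.rpow_add (by norm_num), sub_add_cancel, Real.rpow_one]
end

section
/- Let X be a real normed space and s ∈ (0, 1], and suppose X satisfies the Clarkson-type inequality: for all x, y ∈ X, (‖x+y‖^{2/s} + ‖x−y‖^{2/s})^{s/2} ≤ 2^{s/2} (‖x‖^{2/(2−s)} + ‖y‖^{2/(2−s)})^{(2−s)/2}. Then X is uniformly smooth: for every ε > 0 there exists δ > 0 such that for all t with 0 < t < δ and all x, y ∈ X with ‖x‖ = ‖y‖ = 1, one has ‖x + t·y‖ + ‖x − t·y‖ ≤ 2 + ε·t. -/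
/-- The midpoint of two nonnegative reals is at most their `r⁻¹`-power mean. -/
lemma add_div_two_le_rpow_mean {a b r : ℝ} (ha : 0 ≤ a) (hb : 0 ≤ b) (hr : 0 < r)
    (hr1 : r ≤ 1) : (a + b) / 2 ≤ ((a ^ r⁻¹ + b ^ r⁻¹) / 2) ^ r := by
  have h := (convexOn_rpow ((one_le_inv₀ hr).2 hr1)).2 (Set.mem_Ici.2 ha) (Set.mem_Ici.2 hb)
    (by norm_num : (0 : ℝ) ≤ 1 / 2) (by norm_num : (0 : ℝ) ≤ 1 / 2) (by norm_num)
  simp only [smul_eq_mul] at h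
  have h' := (Real.le_rpow_inv_iff_of_pos (by positivity) (by positivity) (inv_pos.2 hr)).2 h
  rw [inv_inv] at h'
  convert h' using 2 <;> ring

theorem uniformly_smooth_of_clarkson
    {X : Type*} [NormedAddCommGroup X] [NormedSpace ℝ X]
    (s : ℝ) (hs : 0 < s) (hs1 : s ≤ 1)
    (hC : ∀ x y : X,
      (‖x + y‖ ^ (2 / s) + ‖x - y‖ ^ (2 / s)) ^ (s / 2) ≤
        2 ^ (s / 2) * (‖x‖ ^ (2 / (2 - s)) + ‖y‖ ^ (2 / (2 - s))) ^ ((2 - s) / 2)) :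
    ∀ ε : ℝ, 0 < ε → ∃ δ : ℝ, 0 < δ ∧
      ∀ t : ℝ, 0 < t → t < δ →
        ∀ x y : X, ‖x‖ = 1 → ‖y‖ = 1 →
          ‖x + t • y‖ + ‖x - t • y‖ ≤ 2 + ε * t := by
  intro ε hε
  have h2s : 0 < 2 - s := by linarith
  refine ⟨(ε / 2) ^ (s / (2 - s))⁻¹, by positivity, fun t ht htδ x y hx hy => ?_⟩
  have hmean := add_div_two_le_rpow_mean (norm_nonneg (x + t • y)) (norm_nonneg (x - t • y))
    (half_pos hs) (by linarith)
  have hclark := hC x (t • y)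
  rw [norm_smul, hx, hy, Real.norm_of_nonneg ht.le, mul_one, Real.one_rpow] at hclark
  rw [inv_div, Real.div_rpow (by positivity) (by norm_num)] at hmean
  have hroot : (1 + t ^ (2 / (2 - s))) ^ ((2 - s) / 2) ≤ 1 + t ^ (2 / (2 - s)) :=
    Real.rpow_le_self_of_one_le (le_add_of_nonneg_right (by positivity)) (by linarith)
  have hpow : t ^ (2 / (2 - s)) = t ^ (s / (2 - s)) * t := by
    rw [← Real.rpow_add_one ht.ne']
    congr 1
    field_simp
    ring
  have hsmall : t ^ (s / (2 - s)) ≤ ε / 2 :=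
    (Real.le_rpow_inv_iff_of_pos ht.le (by positivity) (by positivity)).1 htδ.le
  have hquot := (div_le_iff₀' (by positivity : (0 : ℝ) < 2 ^ (s / 2))).2 hclark
  nlinarith [mul_le_mul_of_nonneg_right hsmall ht.le]
end
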